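/- Let (B_ℓ)_{ℓ≥1} be a sequence of sets B_ℓ ⊆ {−1,1}^{n_ℓ}. If Σ_{i=1}^{n_ℓ} I_i(B_ℓ)² → 0 as ℓ → ∞, then for every η ∈ (0,1), VAR(B_ℓ, η) → 0 as ℓ → ∞, i.e. the sequence (B_ℓ) is asymptotically noise sensitive. -/

import Mathlib

open Finset

/-- Expectation with respect to the uniform measure `ν` on the discrete cube `{-1,1}ⁿ`,
coordinates encoded by `Bool` (`true ↔ 1`, `false ↔ -1`). -/
noncomputable def cubeE (n : ℕ) (f : (Fin n → Bool) → ℝ) : ℝ :=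
  (∑ x : Fin n → Bool, f x) / 2 ^ n

/-- Variance with respect to the uniform measure on the discrete cube. -/
noncomputable def cubeVar (n : ℕ) (f : (Fin n → Bool) → ℝ) : ℝ :=
  cubeE n (fun x => f x ^ 2) - (cubeE n f) ^ 2

/-- `τ_i x` : flip the `i`-th coordinate. -/
def cubeFlip (n : ℕ) (i : Fin n) (x : Fin n → Bool) : Fin n → Bool :=
  Function.update x i (!(x i))

/-- Discrete derivative `D_i f (x) = f (τ_i x) - f x`. -/
noncomputable def Dop (n : ℕ) (i : Fin n) (f : (Fin n → Bool) → ℝ) (x : Fin n → Bool) : ℝ :=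
  f (cubeFlip n i x) - f x

/-- Joint probability weight for one coordinate of the pair `(X, X^η)`, where `X` is uniform
on `{-1,1}` and `X^η` equals `X` with probability `1-η` and is an independent uniform sign
with probability `η` : `P(X = a, X^η = b)` equals `(2-η)/4` if `a = b` and `η/4` otherwise. -/
noncomputable def nsW (η : ℝ) (a b : Bool) : ℝ := if a = b then (2 - η) / 4 else η / 4

/-- Noise stability `VAR(f,η) = E[f(X) f(X^η)] - (E f)²`, where `(X, X^η)` is the pair of
`(1-η)`-correlated uniform random points of the cube, with explicit joint distribution
`P(X = x, X^η = y) = ∏ᵢ nsW η xᵢ yᵢ`. -/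
noncomputable def cubeNS (n : ℕ) (f : (Fin n → Bool) → ℝ) (η : ℝ) : ℝ :=
  (∑ x : Fin n → Bool, ∑ y : Fin n → Bool, f x * f y * ∏ i, nsW η (x i) (y i)) -
    (cubeE n f) ^ 2

/-- Influence of the `i`-th coordinate on a set `A ⊆ {-1,1}ⁿ`:
`Iᵢ(A) = ν{x : x ∈ A, τᵢ x ∉ A}`. -/
noncomputable def setInfl (n : ℕ) (A : Finset (Fin n → Bool)) (i : Fin n) : ℝ :=
  ((Finset.univ.filter fun x : Fin n → Bool => x ∈ A ∧ cubeFlip n i x ∉ A).card : ℝ) / 2 ^ n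

/-- The sign `±1` encoded by a Boolean. -/
def boolSign (b : Bool) : ℝ := if b then 1 else -1

/-- The Walsh character indexed by `S`. -/
noncomputable def walsh (n : ℕ) (S : Finset (Fin n)) (x : Fin n → Bool) : ℝ :=
  ∏ i ∈ S, boolSign (x i)

/-- The Fourier-Walsh coefficient of `f` at `S`. -/
noncomputable def walshCoeff (n : ℕ) (f : (Fin n → Bool) → ℝ) (S : Finset (Fin n)) : ℝ :=
  cubeE n (fun x => f x * walsh n S x)

/-- Transition kernel of the noise operator with correlation `ρ`. -/
noncomputable def noiseKernel (n : ℕ) (ρ : ℝ) (x y : Fin n → Bool) : ℝ :=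
  ∏ i, (1 + ρ * (boolSign (x i) * boolSign (y i))) / 2

/-- The noise operator with correlation `ρ`. -/
noncomputable def noiseOp (n : ℕ) (ρ : ℝ) (f : (Fin n → Bool) → ℝ) (x : Fin n → Bool) : ℝ :=
  ∑ y, f y * noiseKernel n ρ x y

/-- The `i`-th coordinate Laplacian `(f - f ∘ τ_i) / 2`. -/
noncomputable def coordLaplacian (n : ℕ) (i : Fin n) (f : (Fin n → Bool) → ℝ)
    (x : Fin n → Bool) : ℝ :=
  (f x - f (cubeFlip n i x)) / 2

lemma cubeE_add (n : ℕ) (f g : (Fin n → Bool) → ℝ) :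
    cubeE n (fun x => f x + g x) = cubeE n f + cubeE n g := by
  simp only [cubeE, sum_add_distrib, add_div]

lemma cubeE_const_mul (n : ℕ) (c : ℝ) (f : (Fin n → Bool) → ℝ) :
    cubeE n (fun x => c * f x) = c * cubeE n f := by
  simp only [cubeE, ← mul_sum, mul_div_assoc]

lemma cubeE_mono (n : ℕ) {f g : (Fin n → Bool) → ℝ} (h : ∀ x, f x ≤ g x) :
    cubeE n f ≤ cubeE n g := by
  unfold cubeE
  gcongr with x
  exact h x

lemma cubeE_nonneg (n : ℕ) {f : (Fin n → Bool) → ℝ} (h : ∀ x, 0 ≤ f x) : 0 ≤ cubeE n f :=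
  div_nonneg (sum_nonneg fun x _ => h x) (by positivity)

lemma cubeE_mul_sq_le (n : ℕ) (f g : (Fin n → Bool) → ℝ) :
    cubeE n (fun x => f x * g x) ^ 2 ≤
      cubeE n (fun x => f x ^ 2) * cubeE n (fun x => g x ^ 2) := by
  simp only [cubeE, div_pow, div_mul_div_comm, ← sq]
  gcongr
  exact sum_mul_sq_le_sq_mul_sq _ _ _

lemma sum_cube_succ (n : ℕ) (f : (Fin (n + 1) → Bool) → ℝ) :
    ∑ x, f x = ∑ x : Fin n → Bool,
      (f (Fin.cons true x : Fin (n + 1) → Bool) + f (Fin.cons false x : Fin (n + 1) → Bool)) := by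
  rw [← (Fin.consEquiv fun _ : Fin (n + 1) => Bool).sum_comp, Fintype.sum_prod_type,
    Fintype.sum_bool, ← sum_add_distrib]
  rfl

lemma cubeE_succ (n : ℕ) (f : (Fin (n + 1) → Bool) → ℝ) :
    cubeE (n + 1) f = cubeE n (fun x =>
      (f (Fin.cons true x : Fin (n + 1) → Bool) +
        f (Fin.cons false x : Fin (n + 1) → Bool)) / 2) := by
  simp only [cubeE, sum_cube_succ, ← sum_div]
  rw [pow_succ, div_div, mul_comm]

lemma sum_prod_coord (n : ℕ) (φ : Fin n → Bool → ℝ) :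
    ∑ x : Fin n → Bool, ∏ i, φ i (x i) = ∏ i, (φ i true + φ i false) := by
  rw [← Fintype.piFinset_univ, ← prod_univ_sum]
  simp

lemma noiseKernel_eq_sum (n : ℕ) (ρ : ℝ) (x y : Fin n → Bool) :
    noiseKernel n ρ x y = (∑ S : Finset (Fin n), ρ ^ S.card * (walsh n S x * walsh n S y)) /
      2 ^ n := by
  simp only [noiseKernel, prod_div_distrib, prod_const, card_univ, Fintype.card_fin]
  congr 1
  rw [prod_one_add, powerset_univ]
  refine sum_congr rfl fun S _ => ?_
  rw [prod_mul_distrib, prod_mul_distrib, prod_const]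
  rfl

lemma noiseKernel_one (n : ℕ) (x y : Fin n → Bool) :
    noiseKernel n 1 x y = if x = y then 1 else 0 := by
  have h : ∀ a b : Bool,
      (1 + 1 * (boolSign a * boolSign b)) / 2 = if a = b then (1 : ℝ) else 0 := by
    intro a b; cases a <;> cases b <;> norm_num [boolSign]
  simp only [noiseKernel, h, prod_ite_zero, funext_iff, mem_univ, true_implies, prod_const_one]

lemma noiseKernel_nonneg (n : ℕ) {ρ : ℝ} (h0 : 0 ≤ ρ) (h1 : ρ ≤ 1) (x y : Fin n → Bool) :
    0 ≤ noiseKernel n ρ x y := by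
  refine prod_nonneg fun i _ => ?_
  cases x i <;> cases y i <;> norm_num [boolSign] <;> linarith

lemma sum_walsh_mul_noiseKernel (n : ℕ) (ρ : ℝ) (S : Finset (Fin n)) (y : Fin n → Bool) :
    ∑ x, walsh n S x * noiseKernel n ρ x y = ρ ^ S.card * walsh n S y := by
  classical
  have h : ∀ x, walsh n S x * noiseKernel n ρ x y =
      ∏ i, ((if i ∈ S then boolSign (x i) else 1) *
        ((1 + ρ * (boolSign (x i) * boolSign (y i))) / 2)) := by
    intro x
    rw [prod_mul_distrib, prod_ite_mem, univ_inter]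
    rfl
  simp only [h]
  rw [sum_prod_coord n (fun i b => (if i ∈ S then boolSign b else 1) *
    ((1 + ρ * (boolSign b * boolSign (y i))) / 2))]
  have h2 : ∀ i, ((if i ∈ S then boolSign true else 1) *
      ((1 + ρ * (boolSign true * boolSign (y i))) / 2) +
      (if i ∈ S then boolSign false else 1) *
      ((1 + ρ * (boolSign false * boolSign (y i))) / 2)) =
      if i ∈ S then ρ * boolSign (y i) else 1 := by
    intro i
    by_cases hi : i ∈ S <;> cases y i <;> norm_num [hi, boolSign] <;> ring
  simp only [h2]
  rw [prod_ite_mem, univ_inter, prod_mul_distrib, prod_const]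
  rfl

lemma sum_noiseKernel (n : ℕ) (ρ : ℝ) (y : Fin n → Bool) : ∑ x, noiseKernel n ρ x y = 1 := by
  simpa [walsh] using sum_walsh_mul_noiseKernel n ρ ∅ y

lemma walshCoeff_noiseOp (n : ℕ) (ρ : ℝ) (f : (Fin n → Bool) → ℝ) (S : Finset (Fin n)) :
    walshCoeff n (noiseOp n ρ f) S = ρ ^ S.card * walshCoeff n f S := by
  simp only [walshCoeff, cubeE, noiseOp, sum_mul]
  rw [sum_comm, ← mul_div_assoc, mul_sum]
  congr 1
  refine sum_congr rfl fun y _ => ?_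
  calc ∑ x, f y * noiseKernel n ρ x y * walsh n S x
      = f y * ∑ x, walsh n S x * noiseKernel n ρ x y := by
        rw [mul_sum]; exact sum_congr rfl fun x _ => by ring
    _ = _ := by rw [sum_walsh_mul_noiseKernel]; ring

lemma sum_sum_mul_noiseKernel (n : ℕ) (ρ : ℝ) (f g : (Fin n → Bool) → ℝ) :
    (∑ x, ∑ y, f x * g y * noiseKernel n ρ x y) / 2 ^ n =
      ∑ S : Finset (Fin n), ρ ^ S.card * (walshCoeff n f S * walshCoeff n g S) := by
  have h : ∀ S : Finset (Fin n), ρ ^ S.card * (walshCoeff n f S * walshCoeff n g S) =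
      (∑ x, ∑ y, f x * g y * (ρ ^ S.card * (walsh n S x * walsh n S y)) / 2 ^ n) / 2 ^ n := by
    intro S
    simp only [walshCoeff, cubeE]
    rw [div_mul_div_comm, sum_mul_sum, ← mul_div_assoc, mul_sum, ← div_div]
    simp only [sum_div, mul_sum]
    refine sum_congr rfl fun x _ => sum_congr rfl fun y _ => ?_
    ring
  simp only [h, noiseKernel_eq_sum]
  rw [← sum_div]
  congr 1
  rw [sum_comm (s := univ (α := Finset (Fin n)))]
  refine sum_congr rfl fun x _ => ?_
  rw [sum_comm (s := univ (α := Finset (Fin n)))]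
  refine sum_congr rfl fun y _ => ?_
  rw [← sum_div, ← mul_sum, mul_div_assoc]

lemma cubeE_mul_eq_sum (n : ℕ) (f g : (Fin n → Bool) → ℝ) :
    cubeE n (fun x => f x * g x) =
      ∑ S : Finset (Fin n), walshCoeff n f S * walshCoeff n g S := by
  have := sum_sum_mul_noiseKernel n 1 f g
  simpa [noiseKernel_one, cubeE] using this

lemma cubeE_sq_eq_sum (n : ℕ) (f : (Fin n → Bool) → ℝ) :
    cubeE n (fun x => f x ^ 2) = ∑ S : Finset (Fin n), walshCoeff n f S ^ 2 := by
  simp only [sq, cubeE_mul_eq_sum]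

lemma cubeNS_eq_sum (n : ℕ) (f : (Fin n → Bool) → ℝ) (η : ℝ) :
    cubeNS n f η = ∑ S ∈ univ.erase (∅ : Finset (Fin n)),
      (1 - η) ^ S.card * walshCoeff n f S ^ 2 := by
  have hw : ∀ a b, nsW η a b = (1 + (1 - η) * (boolSign a * boolSign b)) / 2 / 2 := by
    intro a b; cases a <;> cases b <;> norm_num [nsW, boolSign] <;> ring
  have hK : ∀ x y : Fin n → Bool,
      ∏ i, nsW η (x i) (y i) = noiseKernel n (1 - η) x y / 2 ^ n := by
    intro x y
    simp only [hw, noiseKernel]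
    rw [prod_div_distrib (g := fun _ => (2 : ℝ))]
    simp
  have h := sum_sum_mul_noiseKernel n (1 - η) f f
  unfold cubeNS
  simp only [hK, ← mul_div_assoc, ← sum_div, h]
  rw [← add_sum_erase univ _ (mem_univ (∅ : Finset (Fin n)))]
  simp [walshCoeff, walsh, sq]

lemma cubeE_abs_noiseOp_le (n : ℕ) {ρ : ℝ} (h0 : 0 ≤ ρ) (h1 : ρ ≤ 1) (f : (Fin n → Bool) → ℝ) :
    cubeE n (fun x => |noiseOp n ρ f x|) ≤ cubeE n (fun x => |f x|) := by
  unfold cubeE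
  gcongr ?_ / _
  calc ∑ x, |noiseOp n ρ f x| ≤ ∑ x, ∑ y, |f y| * noiseKernel n ρ x y := by
        refine sum_le_sum fun x _ => (abs_sum_le_sum_abs _ _).trans (le_of_eq ?_)
        refine sum_congr rfl fun y _ => ?_
        rw [abs_mul, abs_of_nonneg (noiseKernel_nonneg n h0 h1 x y)]
    _ = ∑ y, |f y| := by
        rw [sum_comm]
        refine sum_congr rfl fun y _ => ?_
        rw [← mul_sum, sum_noiseKernel, mul_one]

lemma noiseOp_linear (n : ℕ) (ρ a b : ℝ) (f g : (Fin n → Bool) → ℝ) (x : Fin n → Bool) :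
    noiseOp n ρ (fun y => a * f y + b * g y) x = a * noiseOp n ρ f x + b * noiseOp n ρ g x := by
  simp only [noiseOp, mul_sum, ← sum_add_distrib]
  exact sum_congr rfl fun y _ => by ring

lemma noiseOp_cons (n : ℕ) (ρ : ℝ) (f : (Fin (n + 1) → Bool) → ℝ) (b : Bool)
    (x : Fin n → Bool) :
    noiseOp (n + 1) ρ f (Fin.cons b x : Fin (n + 1) → Bool) =
      (1 + ρ * boolSign b) / 2 *
        noiseOp n ρ (fun y => f (Fin.cons true y : Fin (n + 1) → Bool)) x +
      (1 - ρ * boolSign b) / 2 *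
        noiseOp n ρ (fun y => f (Fin.cons false y : Fin (n + 1) → Bool)) x := by
  simp only [noiseOp, sum_cube_succ, noiseKernel, Fin.prod_univ_succ, Fin.cons_zero,
    Fin.cons_succ, mul_sum, ← sum_add_distrib]
  refine sum_congr rfl fun y _ => ?_
  simp only [boolSign, if_true, Bool.false_eq_true, if_false]
  ring

/-- The Bonami hypercontractive inequality from `L²` to `L⁴`, at correlation `1/2`. -/
lemma cubeE_noiseOp_pow_four_le (n : ℕ) (f : (Fin n → Bool) → ℝ) :
    cubeE n (fun x => noiseOp n (1 / 2) f x ^ 4) ≤ cubeE n (fun x => f x ^ 2) ^ 2 := by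
  induction n with
  | zero =>
    simp [cubeE, noiseOp, noiseKernel]
    exact le_of_eq (by ring)
  | succ n ih =>
    set F : (Fin n → Bool) → ℝ := fun y => f (Fin.cons true y : Fin (n + 1) → Bool) with hF
    set G : (Fin n → Bool) → ℝ := fun y => f (Fin.cons false y : Fin (n + 1) → Bool) with hG
    set u : (Fin n → Bool) → ℝ := fun y => 1 / 2 * F y + 1 / 2 * G y with hu
    set v : (Fin n → Bool) → ℝ := fun y => 1 / 2 * F y + (-1 / 2) * G y with hv
    have hp := ih u
    have hq := ih v
    set p := noiseOp n (1 / 2) u with hpd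
    set q := noiseOp n (1 / 2) v with hqd
    set A := cubeE n (fun x => u x ^ 2) with hA
    set B := cubeE n (fun x => v x ^ 2) with hB
    have hA0 : 0 ≤ A := cubeE_nonneg n fun x => sq_nonneg _
    have hB0 : 0 ≤ B := cubeE_nonneg n fun x => sq_nonneg _
    have h2 : cubeE (n + 1) (fun x => f x ^ 2) = A + B := by
      rw [cubeE_succ, hA, hB, ← cubeE_add]
      congr 1; funext x
      simp only [hu, hv, hF, hG]; ring
    have h4 : cubeE (n + 1) (fun x => noiseOp (n + 1) (1 / 2) f x ^ 4) =
        cubeE n (fun x => p x ^ 4) + (3 / 2 * cubeE n (fun x => p x ^ 2 * q x ^ 2) +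
          1 / 16 * cubeE n (fun x => q x ^ 4)) := by
      rw [cubeE_succ, ← cubeE_const_mul, ← cubeE_const_mul, ← cubeE_add, ← cubeE_add]
      congr 1; funext x
      rw [noiseOp_cons, noiseOp_cons, hpd, hqd, hu, hv, noiseOp_linear, noiseOp_linear]
      simp only [boolSign, if_true, Bool.false_eq_true, if_false, ← hF, ← hG]
      ring
    have hpq : cubeE n (fun x => p x ^ 2 * q x ^ 2) ≤ A * B := by
      refine le_of_sq_le_sq ?_ (by positivity)
      refine (cubeE_mul_sq_le n _ _).trans ?_
      simp only [← pow_mul]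
      rw [mul_pow]
      refine mul_le_mul hp hq (cubeE_nonneg n fun x => ?_) (sq_nonneg A)
      exact Even.pow_nonneg (by decide) _
    rw [h2, h4]
    nlinarith [mul_nonneg hA0 hB0, sq_nonneg B]

lemma cubeFlip_involutive (n : ℕ) (i : Fin n) : Function.Involutive (cubeFlip n i) := by
  intro x
  simp [cubeFlip]

lemma cubeE_comp_cubeFlip (n : ℕ) (i : Fin n) (f : (Fin n → Bool) → ℝ) :
    cubeE n (fun x => f (cubeFlip n i x)) = cubeE n f := by
  unfold cubeE
  rw [← Equiv.sum_comp (cubeFlip_involutive n i).toPerm f]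
  rfl

lemma walsh_cubeFlip (n : ℕ) (i : Fin n) (S : Finset (Fin n)) (x : Fin n → Bool) :
    walsh n S (cubeFlip n i x) = (if i ∈ S then -1 else 1) * walsh n S x := by
  unfold walsh
  have h : ∀ j, boolSign (cubeFlip n i x j) = (if j = i then -1 else 1) * boolSign (x j) := by
    intro j
    by_cases hj : j = i
    · subst hj
      cases hx : x j <;> simp [cubeFlip, boolSign, hx]
    · simp [cubeFlip, hj]
  simp only [h, prod_mul_distrib, prod_ite_eq']

lemma walshCoeff_coordLaplacian (n : ℕ) (i : Fin n) (f : (Fin n → Bool) → ℝ)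
    (S : Finset (Fin n)) :
    walshCoeff n (coordLaplacian n i f) S = if i ∈ S then walshCoeff n f S else 0 := by
  have h1 : cubeE n (fun x => f (cubeFlip n i x) * walsh n S x) =
      (if i ∈ S then -1 else 1) * walshCoeff n f S := by
    rw [← cubeE_comp_cubeFlip n i, walshCoeff, ← cubeE_const_mul]
    congr 1; funext x
    rw [cubeFlip_involutive n i x, walsh_cubeFlip]
    ring
  have h2 : walshCoeff n (coordLaplacian n i f) S =
      1 / 2 * walshCoeff n f S +
        (-1 / 2) * cubeE n (fun x => f (cubeFlip n i x) * walsh n S x) := by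
    rw [walshCoeff, walshCoeff, ← cubeE_const_mul, ← cubeE_const_mul, ← cubeE_add]
    congr 1; funext x
    simp only [coordLaplacian]; ring
  rw [h2, h1]
  split_ifs <;> ring

lemma sum_sum_walshCoeff_coordLaplacian (n : ℕ) (f : (Fin n → Bool) → ℝ) (c : ℝ) :
    ∑ i, ∑ S : Finset (Fin n), c ^ S.card * walshCoeff n (coordLaplacian n i f) S ^ 2 =
      ∑ S : Finset (Fin n), S.card * c ^ S.card * walshCoeff n f S ^ 2 := by
  rw [sum_comm]
  refine sum_congr rfl fun S _ => ?_
  simp only [walshCoeff_coordLaplacian, ite_pow, mul_ite]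
  simp [mul_assoc]

lemma sum_cubeE_noiseOp_coordLaplacian_sq_le (n : ℕ) (f : (Fin n → Bool) → ℝ) :
    ∑ i, cubeE n (fun x => noiseOp n (1 / 2) (coordLaplacian n i f) x ^ 2) ≤
      cubeE n (fun x => f x ^ 2) := by
  have h : ∀ i, cubeE n (fun x => noiseOp n (1 / 2) (coordLaplacian n i f) x ^ 2) =
      ∑ S : Finset (Fin n), (1 / 4) ^ S.card * walshCoeff n (coordLaplacian n i f) S ^ 2 := by
    intro i
    rw [cubeE_sq_eq_sum]
    refine sum_congr rfl fun S _ => ?_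
    rw [walshCoeff_noiseOp, mul_pow, ← pow_mul, mul_comm S.card, pow_mul]
    norm_num
  simp only [h]
  rw [sum_sum_walshCoeff_coordLaplacian, cubeE_sq_eq_sum]
  refine sum_le_sum fun S _ => mul_le_of_le_one_left (sq_nonneg _) ?_
  rw [one_div, inv_pow, ← div_eq_mul_inv, div_le_one (by positivity)]
  exact_mod_cast (Nat.lt_pow_self (by norm_num)).le

lemma mul_le_truncated {a g m t : ℝ} (ht : 0 < t) (hm : 0 < m) :
    a * g ≤ t * m * |a| + (1 / t * a ^ 2 + 1 / (4 * t * m ^ 2) * g ^ 4) := by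
  have h0 : a * g ≤ |a| * |g| := (le_abs_self _).trans (abs_mul a g).le
  by_cases hg : |g| ≤ t * m
  · have : |a| * |g| ≤ |a| * (t * m) := by gcongr
    have h1 : 0 ≤ 1 / t * a ^ 2 + 1 / (4 * t * m ^ 2) * g ^ 4 := by positivity
    linarith
  · push Not at hg
    have h1 : (t * m) ^ 2 ≤ g ^ 2 := by
      rw [← sq_abs g]; gcongr
    have h2 : 1 / (4 * t * m ^ 2) * g ^ 4 ≥ t / 4 * g ^ 2 := by
      rw [ge_iff_le, div_mul_eq_mul_div, div_mul_eq_mul_div, div_le_div_iff₀ (by norm_num)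
        (by positivity)]
      nlinarith [mul_le_mul_of_nonneg_right h1 (sq_nonneg g)]
    have h3 : |a| * |g| ≤ 1 / t * a ^ 2 + t / 4 * g ^ 2 := by
      have : 1 / t * a ^ 2 + t / 4 * g ^ 2 - |a| * |g| = 1 / t * (|a| - t / 2 * |g|) ^ 2 := by
        rw [← sq_abs a, ← sq_abs g]; field_simp; ring
      have : 0 ≤ 1 / t * (|a| - t / 2 * |g|) ^ 2 := by positivity
      linarith
    have h4 : 0 ≤ t * m * |a| := by positivity
    linarith

/-- If `‖g‖₄ ≤ ‖u‖₂`, the correlation of `a` and `g` is controlled by the `L¹` norm of `a` up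
to an error that is small compared with the `L²` norms. -/
lemma cubeE_mul_le_of_pow_four_le (n : ℕ) (a g u : (Fin n → Bool) → ℝ) {t : ℝ} (ht : 0 < t)
    (h : cubeE n (fun x => g x ^ 4) ≤ cubeE n (fun x => u x ^ 2) ^ 2) :
    cubeE n (fun x => a x * g x) ≤ t ^ 3 * cubeE n (fun x => |a x|) ^ 2 +
      (1 / t * cubeE n (fun x => a x ^ 2) + 1 / t * cubeE n (fun x => u x ^ 2)) := by
  set M := cubeE n (fun x => u x ^ 2)
  have hM : 0 ≤ M := cubeE_nonneg n fun x => sq_nonneg _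
  have hA : 0 ≤ cubeE n (fun x => a x ^ 2) := cubeE_nonneg n fun x => sq_nonneg _
  rcases hM.eq_or_lt with hM0 | hM0
  · have hg : ∀ x, g x = 0 := by
      have h0 : ∑ x, g x ^ 4 ≤ 0 := by
        rw [← hM0] at h
        have := mul_le_mul_of_nonneg_right h (by positivity : (0 : ℝ) ≤ 2 ^ n)
        simpa [cubeE] using this
      intro x
      have := (single_le_sum (f := fun x => g x ^ 4) (fun y _ => by positivity)
        (mem_univ x)).trans h0
      exact pow_eq_zero_iff (by norm_num) |>.1 (le_antisymm this (by positivity))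
    have : cubeE n (fun x => a x * g x) = 0 := by simp [hg, cubeE]
    rw [this]
    positivity
  · set m := √M with hm
    have hm0 : 0 < m := Real.sqrt_pos.2 hM0
    have hmM : m ^ 2 = M := Real.sq_sqrt hM
    set I := cubeE n (fun x => |a x|)
    have h1 : cubeE n (fun x => a x * g x) ≤ t * m * I +
        (1 / t * cubeE n (fun x => a x ^ 2) +
          1 / (4 * t * m ^ 2) * cubeE n (fun x => g x ^ 4)) := by
      rw [← cubeE_const_mul, ← cubeE_const_mul, ← cubeE_const_mul, ← cubeE_add, ← cubeE_add]
      exact cubeE_mono n fun x => mul_le_truncated ht hm0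
    have h2 : 1 / (4 * t * m ^ 2) * cubeE n (fun x => g x ^ 4) ≤ 1 / (4 * t) * M := by
      calc _ ≤ 1 / (4 * t * m ^ 2) * M ^ 2 := by gcongr
        _ = _ := by rw [hmM]; field_simp
    have h3 : t * m * I ≤ t ^ 3 * I ^ 2 + 1 / (4 * t) * M := by
      have : t ^ 3 * I ^ 2 + 1 / (4 * t) * M - t * m * I =
          t ^ 3 * (I - m / (2 * t ^ 2)) ^ 2 := by
        rw [← hmM]; field_simp; ring
      have : 0 ≤ t ^ 3 * (I - m / (2 * t ^ 2)) ^ 2 := by positivity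
      linarith
    have h4 : 1 / (4 * t) * M + 1 / (4 * t) * M ≤ 1 / t * M := by
      have : 1 / t * M - (1 / (4 * t) * M + 1 / (4 * t) * M) = 1 / (2 * t) * M := by
        field_simp; ring
      have : 0 ≤ 1 / (2 * t) * M := by positivity
      linarith
    linarith

lemma cubeNS_seven_eighths_le (n : ℕ) (f : (Fin n → Bool) → ℝ) {t : ℝ} (ht : 0 < t) :
    cubeNS n f (7 / 8) ≤
      t ^ 3 * ∑ i, cubeE n (fun x => |coordLaplacian n i f x|) ^ 2 +
        2 / t * cubeE n (fun x => f x ^ 2) := by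
  set l := fun i => coordLaplacian n i f with hl
  set a := fun i => noiseOp n (1 / 2) (l i) with ha
  have h1 : cubeNS n f (7 / 8) ≤
      ∑ i, cubeE n (fun x => a i x * noiseOp n (1 / 2) (a i) x) := by
    have h2 : ∀ i, cubeE n (fun x => a i x * noiseOp n (1 / 2) (a i) x) =
        ∑ S : Finset (Fin n), (1 / 8) ^ S.card * walshCoeff n (l i) S ^ 2 := by
      intro i
      rw [cubeE_mul_eq_sum]
      refine sum_congr rfl fun S _ => ?_
      simp only [ha, walshCoeff_noiseOp]
      rw [show (1 / 8 : ℝ) = 1 / 2 * (1 / 2 * (1 / 2)) by norm_num, mul_pow, mul_pow]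
      ring
    simp only [h2, hl, sum_sum_walshCoeff_coordLaplacian]
    rw [cubeNS_eq_sum]
    refine (sum_le_sum fun S hS => ?_).trans
      (sum_le_sum_of_subset_of_nonneg (erase_subset _ _) fun S _ _ => by positivity)
    have hc : (1 : ℝ) ≤ S.card := by
      exact_mod_cast card_pos.2 (nonempty_iff_ne_empty.2 (ne_of_mem_erase hS))
    rw [show (1 - 7 / 8 : ℝ) = 1 / 8 by norm_num]
    gcongr
    exact le_mul_of_one_le_left (by positivity) hc
  refine h1.trans ((sum_le_sum fun i _ =>
    cubeE_mul_le_of_pow_four_le n _ _ _ ht (cubeE_noiseOp_pow_four_le n (a i))).trans ?_)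
  rw [sum_add_distrib, sum_add_distrib, ← mul_sum, ← mul_sum]
  have h3 := sum_cubeE_noiseOp_coordLaplacian_sq_le n f
  have h4 : ∑ i, cubeE n (fun x => |a i x|) ^ 2 ≤ ∑ i, cubeE n (fun x => |l i x|) ^ 2 := by
    refine sum_le_sum fun i _ => ?_
    gcongr
    · exact cubeE_nonneg n fun x => abs_nonneg _
    · exact cubeE_abs_noiseOp_le n (by norm_num) (by norm_num) _
  have h5 := mul_le_mul_of_nonneg_left h3 (by positivity : 0 ≤ 1 / t)
  have h6 := mul_le_mul_of_nonneg_left h4 (by positivity : 0 ≤ t ^ 3)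
  have h7 : 2 / t * cubeE n (fun x => f x ^ 2) =
      1 / t * cubeE n (fun x => f x ^ 2) + 1 / t * cubeE n (fun x => f x ^ 2) := by ring
  rw [h7]
  linarith

lemma cubeNS_nonneg (n : ℕ) (f : (Fin n → Bool) → ℝ) {η : ℝ} (h : η ≤ 1) :
    0 ≤ cubeNS n f η := by
  have : 0 ≤ 1 - η := by linarith
  rw [cubeNS_eq_sum]
  positivity

/-- Up to a small error, noise stability at level `η` is controlled by that at level `7/8`. -/
lemma exists_cubeNS_le {η ε : ℝ} (hη : η ∈ Set.Ioo (0 : ℝ) 1) (hε : 0 < ε) :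
    ∃ C : ℝ, 0 < C ∧ ∀ (n : ℕ) (f : (Fin n → Bool) → ℝ),
      cubeNS n f η ≤ ε * cubeE n (fun x => f x ^ 2) + C * cubeNS n f (7 / 8) := by
  have h0 : 0 ≤ 1 - η := by linarith [hη.2]
  have h1 : 1 - η < 1 := by linarith [hη.1]
  obtain ⟨D, hD⟩ := exists_pow_lt_of_lt_one hε h1
  refine ⟨8 ^ D, by positivity, fun n f => ?_⟩
  have key : ∀ d : ℕ, (1 - η) ^ d ≤ ε + 8 ^ D * (1 / 8) ^ d := by
    intro d
    rcases le_total D d with hd | hd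
    · have : (1 - η) ^ d ≤ (1 - η) ^ D := pow_le_pow_of_le_one h0 h1.le hd
      have : (0 : ℝ) ≤ 8 ^ D * (1 / 8) ^ d := by positivity
      linarith
    · have : (1 - η) ^ d ≤ 1 := pow_le_one₀ h0 h1.le
      have : (1 : ℝ) ≤ 8 ^ D * (1 / 8) ^ d := by
        rw [one_div, inv_pow, ← div_eq_mul_inv, one_le_div (by positivity)]
        exact pow_le_pow_right₀ (by norm_num) hd
      linarith
  have hP : ∑ S ∈ univ.erase (∅ : Finset (Fin n)), walshCoeff n f S ^ 2 ≤
      cubeE n (fun x => f x ^ 2) := by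
    rw [cubeE_sq_eq_sum]
    exact sum_le_sum_of_subset_of_nonneg (erase_subset _ _) fun S _ _ => by positivity
  calc cubeNS n f η ≤ ∑ S ∈ univ.erase (∅ : Finset (Fin n)),
        (ε * walshCoeff n f S ^ 2 + 8 ^ D * ((1 - 7 / 8) ^ S.card * walshCoeff n f S ^ 2)) := by
        rw [cubeNS_eq_sum]
        refine sum_le_sum fun S _ => ?_
        rw [show (1 - 7 / 8 : ℝ) = 1 / 8 by norm_num, ← mul_assoc, ← add_mul]
        gcongr
        exact key _
    _ = ε * ∑ S ∈ univ.erase (∅ : Finset (Fin n)), walshCoeff n f S ^ 2 +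
        8 ^ D * cubeNS n f (7 / 8) := by
        rw [sum_add_distrib, ← mul_sum, ← mul_sum, cubeNS_eq_sum]
    _ ≤ _ := by gcongr

lemma cubeE_indicator_sq_le_one (n : ℕ) (A : Finset (Fin n → Bool)) :
    cubeE n (fun x => (if x ∈ A then (1 : ℝ) else 0) ^ 2) ≤ 1 := by
  refine (cubeE_mono n (g := fun _ => 1) fun x => ?_).trans (le_of_eq ?_)
  · split_ifs <;> norm_num
  · simp [cubeE]

lemma cubeE_abs_coordLaplacian_indicator (n : ℕ) (A : Finset (Fin n → Bool)) (i : Fin n) :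
    cubeE n (fun x => |coordLaplacian n i (fun x => if x ∈ A then (1 : ℝ) else 0) x|) =
      setInfl n A i := by
  have h1 : setInfl n A i = cubeE n (fun x => if x ∈ A ∧ cubeFlip n i x ∉ A then 1 else 0) := by
    simp [setInfl, cubeE]
  have h2 := cubeE_comp_cubeFlip n i (fun x => if x ∈ A ∧ cubeFlip n i x ∉ A then 1 else 0)
  rw [← h1] at h2
  have h3 : setInfl n A i = 1 / 2 * setInfl n A i + 1 / 2 * setInfl n A i := by ring
  rw [h3]
  nth_rw 1 [h1]
  rw [← h2, ← cubeE_const_mul, ← cubeE_const_mul, ← cubeE_add]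
  congr 1; funext x
  simp only [coordLaplacian, cubeFlip_involutive n i x]
  by_cases hx : x ∈ A <;> by_cases hy : cubeFlip n i x ∈ A <;> simp [hx, hy]
  norm_num

/-- Benjamini--Kalai--Schramm: if `∑ᵢ Iᵢ(B_ℓ)² → 0` as `ℓ → ∞`, then the
sequence of sets `(B_ℓ)` is asymptotically noise sensitive: for every `η ∈ (0,1)`,
`VAR(B_ℓ, η) → 0`. -/
theorem stmt18 (nl : ℕ → ℕ) (B : ∀ ℓ : ℕ, Finset (Fin (nl ℓ) → Bool))
    (h : Filter.Tendsto (fun ℓ => ∑ i : Fin (nl ℓ), (setInfl (nl ℓ) (B ℓ) i) ^ 2)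
      Filter.atTop (nhds 0)) :
    ∀ η ∈ Set.Ioo (0 : ℝ) 1,
      Filter.Tendsto
        (fun ℓ => cubeNS (nl ℓ) (fun x => if x ∈ B ℓ then (1 : ℝ) else 0) η)
        Filter.atTop (nhds 0) := by
  intro η hη
  rw [Metric.tendsto_atTop] at h ⊢
  intro ε hε
  obtain ⟨C, hC, hNS⟩ := exists_cubeNS_le hη (by positivity : 0 < ε / 4)
  set t := 8 * C / ε with ht_def
  have ht : 0 < t := by positivity
  obtain ⟨N, hN⟩ := h (ε / (4 * C * t ^ 3)) (by positivity)
  refine ⟨N, fun ℓ hℓ => ?_⟩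
  have hW := (le_abs_self _).trans_lt (by simpa [Real.dist_eq] using hN ℓ hℓ)
  set f := fun x => if x ∈ B ℓ then (1 : ℝ) else 0 with hf
  rw [Real.dist_eq, sub_zero, abs_of_nonneg (cubeNS_nonneg _ _ hη.2.le)]
  have h1 := hNS (nl ℓ) f
  have h2 := cubeNS_seven_eighths_le (nl ℓ) f ht
  simp only [hf, cubeE_abs_coordLaplacian_indicator] at h2
  rw [← hf] at h2
  have h3 : cubeE (nl ℓ) (fun x => f x ^ 2) ≤ 1 := cubeE_indicator_sq_le_one _ _
  set W := ∑ i, setInfl (nl ℓ) (B ℓ) i ^ 2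
  have h4 : C * (t ^ 3 * W) < ε / 4 := by
    rw [lt_div_iff₀ (by positivity)] at hW
    linarith
  have h5 : C * (2 / t) = ε / 4 := by
    rw [ht_def]; field_simp; norm_num
  have h6 : 2 / t * cubeE (nl ℓ) (fun x => f x ^ 2) ≤ 2 / t :=
    mul_le_of_le_one_right (by positivity) h3
  have h7 : ε / 4 * cubeE (nl ℓ) (fun x => f x ^ 2) ≤ ε / 4 :=
    mul_le_of_le_one_right (by positivity) h3
  have h8 : C * cubeNS (nl ℓ) f (7 / 8) ≤ C * (t ^ 3 * W + 2 / t) := by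
    gcongr
    linarith
  linarith
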